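/- For every odd integer n > 1, sum_{k=0}^{n-1} [4k-1] (q^{-1};q^2)_k^4 / (q^2;q^2)_k^4 · q^{4k} ≡ -(1+3q+q^2)[n]^4 (mod [n]^4 Φ_n(q)). -/

import Mathlib

open RatFunc

noncomputable def q : RatFunc ℚ := RatFunc.X

/-- q-shifted factorial `(a;b)_m = ∏_{j=0}^{m-1} (1 - a b^j)`. -/
noncomputable def qpoch (a b : RatFunc ℚ) (m : ℕ) : RatFunc ℚ :=
  ∏ j ∈ Finset.range m, (1 - a * b ^ j)

/-- q-integer `[m] = (1-q^m)/(1-q)` for an arbitrary integer `m`. -/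
noncomputable def qintZ (m : ℤ) : RatFunc ℚ := (1 - q ^ m) / (1 - q)

/-- q-integer `[m] = 1 + q + ⋯ + q^{m-1}`. -/
noncomputable def qint (m : ℕ) : RatFunc ℚ := ∑ i ∈ Finset.range m, q ^ i

/-- q-binomial coefficient `(q;q)_n / ((q;q)_k (q;q)_{n-k})`. -/
noncomputable def qbinom (n k : ℕ) : RatFunc ℚ :=
  qpoch q q n / (qpoch q q k * qpoch q q (n - k))

/-- the polynomial `[n] = 1 + q + ⋯ + q^{n-1}` in `ℚ[q]` -/
noncomputable def qintP (n : ℕ) : Polynomial ℚ := ∑ i ∈ Finset.range n, Polynomial.X ^ i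

open Polynomial in
/-- `(X;X)_m` as a polynomial. -/
noncomputable def qfactP (m : ℕ) : ℚ[X] := ∏ i ∈ Finset.range m, (1 - Polynomial.X ^ (i + 1))

open Polynomial in
/-- The Gaussian binomial coefficient `[a+b choose a]`, defined by the `q`-Pascal rule. -/
noncomputable def gaussP : ℕ → ℕ → ℚ[X]
  | 0, _ => 1
  | _ + 1, 0 => 1
  | a + 1, b + 1 => gaussP a (b + 1) + Polynomial.X ^ (a + 1) * gaussP (a + 1) b

open Polynomial in
/-- `(-X;X)_m` as a polynomial. -/
noncomputable def qnegP (m : ℕ) : ℚ[X] := ∏ i ∈ Finset.range m, (1 + Polynomial.X ^ (i + 1))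

open Polynomial in
/-- The `q`-Catalan number `[2m+2 choose m+1] / [m+2]`. -/
noncomputable def qcatP (m : ℕ) : ℚ[X] :=
  gaussP (m + 1) (m + 1) - Polynomial.X * gaussP (m + 2) m

section Polynomials

open Polynomial

lemma qfactP_succ (m : ℕ) : qfactP (m + 1) = qfactP m * (1 - Polynomial.X ^ (m + 1)) :=
  Finset.prod_range_succ _ _

lemma one_sub_X_pow_ne_zero (m : ℕ) : (1 - Polynomial.X ^ (m + 1) : ℚ[X]) ≠ 0 := by
  rw [← neg_ne_zero, neg_sub]
  exact (monic_X_pow_sub_C 1 m.succ_ne_zero).ne_zero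

lemma qfactP_ne_zero (m : ℕ) : qfactP m ≠ 0 :=
  Finset.prod_ne_zero_iff.mpr fun i _ => one_sub_X_pow_ne_zero i

lemma gaussP_mul_qfactP (a b : ℕ) : gaussP a b * (qfactP a * qfactP b) = qfactP (a + b) := by
  induction a, b using gaussP.induct with
  | case1 b => simp [gaussP, qfactP]
  | case2 a => simp [gaussP, qfactP]
  | case3 a b ih1 ih2 =>
    rw [gaussP, show a + 1 + (b + 1) = (a + b + 1) + 1 by ring, qfactP_succ (a + b + 1)]
    rw [show a + (b + 1) = a + b + 1 by ring, qfactP_succ b] at ih1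
    rw [show a + 1 + b = a + b + 1 by ring, qfactP_succ a] at ih2
    rw [qfactP_succ a, qfactP_succ b]
    linear_combination (1 - Polynomial.X ^ (a + 1)) * ih1
      + Polynomial.X ^ (a + 1) * (1 - Polynomial.X ^ (b + 1)) * ih2

lemma qcatP_mul_qfactP (m : ℕ) :
    qcatP m * (qfactP (m + 1) * qfactP (m + 2)) = (1 - Polynomial.X) * qfactP (2 * m + 2) := by
  have h1 := gaussP_mul_qfactP (m + 1) (m + 1)
  have h2 := gaussP_mul_qfactP (m + 2) m
  rw [show m + 1 + (m + 1) = 2 * m + 2 by ring] at h1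
  rw [show m + 2 + m = 2 * m + 2 by ring] at h2
  rw [qcatP, qfactP_succ (m + 1)]
  rw [qfactP_succ (m + 1)] at h2
  have h3 := qfactP_succ m
  linear_combination (1 - Polynomial.X ^ (m + 2)) * h1
    - Polynomial.X * (1 - Polynomial.X ^ (m + 1)) * h2
    - Polynomial.X * gaussP (m + 2) m * qfactP (m + 1) * (1 - Polynomial.X ^ (m + 1 + 1)) * h3

lemma qcatP_mul_qfactP' (m : ℕ) :
    qcatP m * qfactP (m + 1) =
      (1 - Polynomial.X) * ∏ i ∈ Finset.range m, (1 - Polynomial.X ^ (m + 2 + i + 1)) := by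
  refine mul_right_cancel₀ (qfactP_ne_zero (m + 2)) ?_
  have h : qfactP (2 * m + 2) =
      qfactP (m + 2) * ∏ i ∈ Finset.range m, (1 - Polynomial.X ^ (m + 2 + i + 1)) := by
    rw [show 2 * m + 2 = (m + 2) + m by ring, qfactP, Finset.prod_range_add]; rfl
  linear_combination qcatP_mul_qfactP m + (1 - Polynomial.X) * h

lemma qintP_mul (n : ℕ) : qintP n * (1 - Polynomial.X) = 1 - Polynomial.X ^ n := by
  have := geom_sum_mul (Polynomial.X : ℚ[X]) n
  rw [qintP]; linear_combination -this

lemma isCoprime_one_add_X_pow {n : ℕ} (hn : Odd n) (j : ℕ) :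
    IsCoprime (1 + Polynomial.X ^ j : ℚ[X]) (Polynomial.X ^ n - 1) := by
  obtain ⟨u, hu⟩ : (1 + Polynomial.X ^ j : ℚ[X]) ∣ 1 + Polynomial.X ^ (j * n) := by
    simpa [pow_mul] using hn.add_dvd_pow_add_pow (1 : ℚ[X]) (Polynomial.X ^ j)
  obtain ⟨v, hv⟩ : (Polynomial.X ^ n - 1 : ℚ[X]) ∣ Polynomial.X ^ (j * n) - 1 := by
    rw [mul_comm, pow_mul]
    simpa using sub_dvd_pow_sub_pow (Polynomial.X ^ n : ℚ[X]) 1 j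
  refine ⟨Polynomial.C (1 / 2) * u, -Polynomial.C (1 / 2) * v, ?_⟩
  have h2 : (Polynomial.C (1 / 2) : ℚ[X]) * 2 = 1 := by
    rw [← C_ofNat, ← C_mul]; norm_num
  linear_combination -Polynomial.C (1 / 2) * hu + Polynomial.C (1 / 2) * hv + h2

lemma isCoprime_X_X_pow_sub_one {n : ℕ} (hn : n ≠ 0) :
    IsCoprime (Polynomial.X : ℚ[X]) (Polynomial.X ^ n - 1) := by
  obtain ⟨m, rfl⟩ := Nat.exists_eq_succ_of_ne_zero hn
  exact ⟨Polynomial.X ^ m, -1, by rw [Nat.succ_eq_add_one]; ring⟩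

lemma prod_one_add_pow_of_isPrimitiveRoot {m : ℕ} (hm : Odd (m + 1)) {ζ : ℂ}
    (hζ : IsPrimitiveRoot ζ (m + 1)) : ∏ i ∈ Finset.range m, (1 + ζ ^ (i + 1)) = 1 := by
  have h := hζ.pow_add_pow_eq_prod_add_mul (1 : ℂ) 1 hm
  have himg : nthRootsFinset (m + 1) (1 : ℂ) = (Finset.range (m + 1)).image (ζ ^ ·) := by
    symm
    apply Finset.eq_of_subset_of_card_le
    · intro x hx
      obtain ⟨i, -, rfl⟩ := Finset.mem_image.mp hx
      rw [mem_nthRootsFinset m.succ_pos, ← pow_mul, mul_comm, pow_mul, hζ.pow_eq_one, one_pow]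
    · rw [hζ.card_nthRootsFinset, Finset.card_image_of_injOn, Finset.card_range]
      intro i hi j hj hij
      exact hζ.pow_inj (Finset.mem_range.mp hi) (Finset.mem_range.mp hj) hij
  rw [himg, Finset.prod_image, Finset.prod_range_succ'] at h
  · simp only [one_pow, mul_one, pow_zero] at h
    have h' : (∏ i ∈ Finset.range m, (1 + ζ ^ (i + 1))) * 2 = 1 * 2 := by
      rw [one_mul, ← one_add_one_eq_two]; exact h.symm
    exact mul_right_cancel₀ two_ne_zero h'
  · intro i hi j hj hij
    exact hζ.pow_inj (Finset.mem_range.mp hi) (Finset.mem_range.mp hj) hij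

lemma aeval_qcatP_of_isPrimitiveRoot {m : ℕ} {ζ : ℂ}
    (hζ : IsPrimitiveRoot ζ (m + 2)) : aeval ζ (qcatP m) = -ζ := by
  have h := congrArg (aeval ζ) (qcatP_mul_qfactP' m)
  rw [qfactP_succ] at h
  simp only [qfactP, map_mul, map_prod, map_sub, map_one, map_pow, aeval_X] at h
  simp only [add_assoc (m + 2), pow_add ζ (m + 2), hζ.pow_eq_one, one_mul] at h
  have h0 : ∏ i ∈ Finset.range m, (1 - ζ ^ (i + 1)) ≠ 0 := by
    refine Finset.prod_ne_zero_iff.mpr fun i hi => sub_ne_zero.mpr fun h1 => ?_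
    exact hζ.pow_ne_one_of_pos_of_lt i.succ_ne_zero
      (by have := Finset.mem_range.mp hi; omega) h1.symm
  have h1 : aeval ζ (qcatP m) * (1 - ζ ^ (m + 1)) = 1 - ζ := by
    refine mul_right_cancel₀ h0 ?_
    linear_combination h
  have h2 : ζ ^ (m + 1) * ζ = 1 := by rw [← pow_succ]; exact hζ.pow_eq_one
  have h3 : (ζ - 1) ≠ 0 := sub_ne_zero.mpr (hζ.ne_one (by omega))
  refine mul_right_cancel₀ h3 ?_
  linear_combination ζ * h1 + aeval ζ (qcatP m) * h2

lemma cyclotomic_dvd_remainder {m : ℕ} (hm : Odd (m + 2)) :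
    cyclotomic (m + 2) ℚ ∣
      (1 + 3 * Polynomial.X + Polynomial.X ^ 2)
          * (Polynomial.X * (1 + Polynomial.X) * qnegP (m + 1) ^ 8)
        - qcatP m ^ 4
          * (Polynomial.X * (2 * qintP (2 * m + 2) + Polynomial.X ^ (2 * m + 2)) ^ 2 + 1) := by
  have hζ := Complex.isPrimitiveRoot_exp (m + 2) (by omega)
  set ζ := Complex.exp (2 * Real.pi * Complex.I / (m + 2 : ℕ))
  rw [cyclotomic_eq_minpoly_rat hζ (by omega), minpoly.dvd_iff]
  have hE : aeval ζ (qnegP (m + 1)) = 1 := by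
    simpa [qnegP] using prod_one_add_pow_of_isPrimitiveRoot hm hζ
  have hA := aeval_qcatP_of_isPrimitiveRoot hζ
  have hY : ζ ^ 2 * ζ ^ (2 * m + 2) = 1 := by
    rw [← pow_add, show 2 + (2 * m + 2) = (m + 2) * 2 by ring, pow_mul, hζ.pow_eq_one, one_pow]
  have hs := congrArg (aeval ζ) (qintP_mul (2 * m + 2))
  simp only [map_mul, map_sub, map_one, map_pow, aeval_X] at hs
  have h1 : 1 - ζ ≠ 0 := sub_ne_zero.mpr (hζ.ne_one (by omega)).symm
  have hs' : ζ ^ 2 * aeval ζ (qintP (2 * m + 2)) = -(1 + ζ) := by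
    refine mul_right_cancel₀ h1 ?_
    linear_combination ζ ^ 2 * hs - hY
  have hz : ζ ^ 2 * (2 * aeval ζ (qintP (2 * m + 2)) + ζ ^ (2 * m + 2)) = -(1 + 2 * ζ) := by
    linear_combination 2 * hs' + hY
  simp only [map_mul, map_sub, map_add, map_one, map_pow, map_ofNat, aeval_X, hE, hA]
  linear_combination -ζ * (ζ ^ 2 * (2 * aeval ζ (qintP (2 * m + 2)) + ζ ^ (2 * m + 2))
    - (1 + 2 * ζ)) * hz

end Polynomials

lemma one_sub_q_pow_ne_zero (m : ℕ) : 1 - q ^ (m + 1) ≠ 0 := by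
  have h := (map_ne_zero_iff _ (IsFractionRing.injective (Polynomial ℚ) (RatFunc ℚ))).mpr
    (one_sub_X_pow_ne_zero m)
  simpa [q] using h

lemma q_ne_zero : q ≠ 0 := RatFunc.X_ne_zero

lemma one_sub_q_ne_zero : 1 - q ≠ 0 := by simpa using one_sub_q_pow_ne_zero 0

lemma one_add_q_ne_zero : 1 + q ≠ 0 := fun h =>
  one_sub_q_pow_ne_zero 1 (by linear_combination (1 - q) * h)

lemma qpoch_sq_ne_zero (m : ℕ) : qpoch (q ^ 2) (q ^ 2) m ≠ 0 := by
  refine Finset.prod_ne_zero_iff.mpr fun i _ => ?_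
  have h := one_sub_q_pow_ne_zero (2 * i + 1)
  rwa [show q ^ 2 * (q ^ 2) ^ i = q ^ (2 * i + 1 + 1) by ring]

lemma qpoch_inv_succ (m : ℕ) :
    qpoch q⁻¹ (q ^ 2) (m + 1) = (1 - q⁻¹) * qpoch q (q ^ 2) m := by
  rw [qpoch, Finset.prod_range_succ', mul_comm, pow_zero, mul_one, qpoch]
  congr 1
  refine Finset.prod_congr rfl fun i _ => ?_
  have := q_ne_zero
  field_simp
  ring

/-- Closed form of the partial sums. -/
lemma sum_qintZ_mul_qpoch (N : ℕ) :
    ∑ k ∈ Finset.range (N + 1),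
        qintZ (4 * k - 1) * qpoch q⁻¹ (q ^ 2) k ^ 4 / qpoch (q ^ 2) (q ^ 2) k ^ 4 * q ^ (4 * k)
      = -(qpoch q (q ^ 2) N / qpoch (q ^ 2) (q ^ 2) N) ^ 4
          * (q * (2 - (1 + q) * q ^ (2 * N)) ^ 2 + (1 - q) ^ 2)
          / (q * (1 - q) ^ 2 * (1 + q)) := by
  have hq := q_ne_zero
  have h1 := one_sub_q_ne_zero
  have h2 := one_add_q_ne_zero
  induction N with
  | zero =>
    simp only [zero_add, Finset.sum_range_one, qintZ, qpoch, Finset.range_zero, Finset.prod_empty,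
      Nat.cast_zero, mul_zero, zero_sub, zpow_neg_one, pow_zero]
    field_simp
    ring
  | succ N ih =>
    rw [Finset.sum_range_succ, ih, qpoch_inv_succ]
    have hz : qintZ (4 * ((N + 1 : ℕ) : ℤ) - 1) = (1 - q ^ (4 * N + 3)) / (1 - q) := by
      rw [qintZ, ← zpow_natCast]; congr 3; push_cast; ring
    have ha : qpoch q (q ^ 2) (N + 1) = qpoch q (q ^ 2) N * (1 - q * q ^ (2 * N)) := by
      rw [qpoch, Finset.prod_range_succ, ← pow_mul]; rfl
    have hb : qpoch (q ^ 2) (q ^ 2) (N + 1)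
        = qpoch (q ^ 2) (q ^ 2) N * (1 - q ^ 2 * q ^ (2 * N)) := by
      rw [qpoch, Finset.prod_range_succ, ← pow_mul]; rfl
    have hb0 := qpoch_sq_ne_zero N
    have hy0 : 1 - q ^ 2 * q ^ (2 * N) ≠ 0 := by
      have := one_sub_q_pow_ne_zero (2 * N + 1)
      rwa [← pow_add, show 2 + 2 * N = 2 * N + 1 + 1 by ring]
    rw [hz, ha, hb, show q ^ (4 * N + 3) = q ^ 3 * (q ^ (2 * N)) ^ 2 by ring,
      show q ^ (4 * (N + 1)) = q ^ 4 * (q ^ (2 * N)) ^ 2 by ring,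
      show q ^ (2 * (N + 1)) = q ^ 2 * q ^ (2 * N) by ring]
    generalize q ^ (2 * N) = y at *
    generalize qpoch q (q ^ 2) N = a at *
    generalize qpoch (q ^ 2) (q ^ 2) N = b at *
    field_simp
    ring

lemma algebraMap_X_eq_q : algebraMap (Polynomial ℚ) (RatFunc ℚ) Polynomial.X = q :=
  RatFunc.algebraMap_X

lemma algebraMap_qintP (n : ℕ) : algebraMap (Polynomial ℚ) (RatFunc ℚ) (qintP n) = qint n := by
  simp [qintP, qint, q]

lemma qpoch_mul_qpoch (m : ℕ) :
    qpoch q (q ^ 2) m * qpoch (q ^ 2) (q ^ 2) m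
      = algebraMap (Polynomial ℚ) (RatFunc ℚ) (qfactP (2 * m)) := by
  induction m with
  | zero => simp [qpoch, qfactP]
  | succ m ih =>
    rw [show 2 * (m + 1) = 2 * m + 1 + 1 by ring, qfactP_succ, qfactP_succ]
    simp only [map_mul, map_sub, map_one, map_pow, algebraMap_X_eq_q, ← ih]
    simp only [qpoch, Finset.prod_range_succ]
    ring

lemma qpoch_sq (m : ℕ) :
    qpoch (q ^ 2) (q ^ 2) m
      = algebraMap (Polynomial ℚ) (RatFunc ℚ) (qfactP m * qnegP m) := by
  rw [qfactP, qnegP, ← Finset.prod_mul_distrib, map_prod, qpoch]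
  refine Finset.prod_congr rfl fun i _ => ?_
  simp only [map_mul, map_sub, map_add, map_one, map_pow, algebraMap_X_eq_q]
  ring

lemma qpoch_div_qpoch (m : ℕ) :
    qpoch q (q ^ 2) (m + 1) / qpoch (q ^ 2) (q ^ 2) (m + 1)
        * algebraMap (Polynomial ℚ) (RatFunc ℚ) (qnegP (m + 1)) ^ 2
      = qint (m + 2) * algebraMap (Polynomial ℚ) (RatFunc ℚ) (qcatP m) := by
  have hb0 := qpoch_sq_ne_zero (m + 1)
  have hmul := qpoch_mul_qpoch (m + 1)
  have hsq := qpoch_sq (m + 1)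
  have hcat : qfactP (2 * (m + 1)) = qintP (m + 2) * qcatP m * qfactP (m + 1) ^ 2 := by
    refine mul_left_cancel₀ (by simpa using one_sub_X_pow_ne_zero 0 :
      (1 - Polynomial.X : Polynomial ℚ) ≠ 0) ?_
    have h := qcatP_mul_qfactP m
    rw [qfactP_succ (m + 1)] at h
    rw [show 2 * (m + 1) = 2 * m + 2 by ring]
    linear_combination -h - qcatP m * qfactP (m + 1) ^ 2 * qintP_mul (m + 2)
  rw [hcat, map_mul, map_mul, map_pow, algebraMap_qintP] at hmul
  rw [map_mul] at hsq
  rw [div_mul_eq_mul_div, div_eq_iff hb0]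
  refine mul_right_cancel₀ hb0 ?_
  rw [hsq] at hmul ⊢
  linear_combination algebraMap (Polynomial ℚ) (RatFunc ℚ) (qnegP (m + 1)) ^ 2 * hmul

theorem supercongruence_full (n : ℕ) (hn : Odd n) (hn1 : 1 < n) :
    ∃ N D : Polynomial ℚ,
      IsCoprime D (qintP n * Polynomial.cyclotomic n ℚ) ∧
      algebraMap (Polynomial ℚ) (RatFunc ℚ) D *
          ((∑ k ∈ Finset.range n,
              qintZ (4 * k - 1) * qpoch q⁻¹ (q ^ 2) k ^ 4 / qpoch (q ^ 2) (q ^ 2) k ^ 4 *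
                q ^ (4 * k))
            - (-(1 + 3 * q + q ^ 2) * qint n ^ 4))
        = algebraMap (Polynomial ℚ) (RatFunc ℚ) N ∧
      qintP n ^ 4 * Polynomial.cyclotomic n ℚ ∣ N := by
  obtain ⟨m, rfl⟩ : ∃ m, n = m + 2 := ⟨n - 2, by omega⟩
  set B := qnegP (m + 1) with hB
  set H := Polynomial.X * (2 * qintP (2 * m + 2) + Polynomial.X ^ (2 * m + 2)) ^ 2 + 1 with hH
  have hdvd : qintP (m + 2) ∣ Polynomial.X ^ (m + 2) - 1 :=
    ⟨Polynomial.X - 1, by linear_combination qintP_mul (m + 2)⟩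
  have hcop {d : Polynomial ℚ} (hd : IsCoprime d (Polynomial.X ^ (m + 2) - 1)) :
      IsCoprime d (qintP (m + 2) * Polynomial.cyclotomic (m + 2) ℚ) :=
    (hd.of_isCoprime_of_dvd_right hdvd).mul_right
      (hd.of_isCoprime_of_dvd_right (Polynomial.cyclotomic.dvd_X_pow_sub_one _ _))
  refine ⟨qintP (m + 2) ^ 4 * ((1 + 3 * Polynomial.X + Polynomial.X ^ 2)
      * (Polynomial.X * (1 + Polynomial.X) * B ^ 8) - qcatP m ^ 4 * H),
    Polynomial.X * (1 + Polynomial.X) * B ^ 8, hcop ?_, ?_,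
    mul_dvd_mul_left _ (cyclotomic_dvd_remainder hn)⟩
  · refine ((isCoprime_X_X_pow_sub_one (by omega)).mul_left ?_).mul_left (IsCoprime.pow_left ?_)
    · simpa using isCoprime_one_add_X_pow hn 1
    · exact IsCoprime.prod_left fun i _ => isCoprime_one_add_X_pow hn (i + 1)
  · have hq := q_ne_zero
    have h1 := one_sub_q_ne_zero
    have h2 := one_add_q_ne_zero
    have hC := qpoch_div_qpoch m
    have hs := congrArg (algebraMap (Polynomial ℚ) (RatFunc ℚ)) (qintP_mul (2 * m + 2))
    rw [show m + 2 = (m + 1) + 1 by ring, sum_qintZ_mul_qpoch (m + 1),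
      show m + 1 + 1 = m + 2 by ring, show 2 * (m + 1) = 2 * m + 2 by ring, hH]
    simp only [map_mul, map_sub, map_add, map_one, map_pow, map_ofNat, algebraMap_X_eq_q,
      algebraMap_qintP] at hs ⊢
    have hfac : q * (2 - (1 + q) * q ^ (2 * m + 2)) ^ 2 + (1 - q) ^ 2
        = (1 - q) ^ 2 * (q * (2 * qint (2 * m + 2) + q ^ (2 * m + 2)) ^ 2 + 1) := by
      have : 2 - (1 + q) * q ^ (2 * m + 2)
          = (1 - q) * (2 * qint (2 * m + 2) + q ^ (2 * m + 2)) := by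
        linear_combination -2 * hs
      rw [this]; ring
    have hC4 := congrArg (· ^ 4) hC
    simp only [mul_pow, ← pow_mul] at hC4
    rw [hfac]
    generalize q * (2 * qint (2 * m + 2) + q ^ (2 * m + 2)) ^ 2 + 1 = h at *
    generalize qpoch q (q ^ 2) (m + 1) / qpoch (q ^ 2) (q ^ 2) (m + 1) = c at *
    generalize algebraMap (Polynomial ℚ) (RatFunc ℚ) (qcatP m) = A at *
    rw [hB]
    generalize algebraMap (Polynomial ℚ) (RatFunc ℚ) (qnegP (m + 1)) = E at *
    generalize qint (m + 2) = s at *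
    field_simp
    linear_combination -h * hC4
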